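/- Let a_n = p_n be the n-th prime and let ε > 0. Then for Lebesgue-almost all α ∈ [0,1] there exists N₀(α) such that for all N ≥ N₀(α) one has δ_min^α(N) ≥ 1/(N (log N)² (log₂ N)(log₃ N)^{1+ε}). -/

import Mathlib

open MeasureTheory Filter

/-- Distance to the nearest integer. -/
noncomputable def nint (x : ℝ) : ℝ := |x - round x|

/-- `δ_min^α(N) = min { ‖(a_m - a_n) α‖ : 1 ≤ m, n ≤ N, m ≠ n }`. -/
noncomputable def deltaMin (a : ℕ → ℕ) (α : ℝ) (N : ℕ) : ℝ :=
  sInf {x : ℝ | ∃ m n : ℕ, 1 ≤ m ∧ m ≤ N ∧ 1 ≤ n ∧ n ≤ N ∧ m ≠ n ∧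
    x = nint (((a m : ℝ) - (a n : ℝ)) * α)}

/-- `C_N = #(A_N - A_N)` where `A_N = {a_1, …, a_N}`. -/
noncomputable def diffCard (a : ℕ → ℕ) (N : ℕ) : ℕ :=
  (((Finset.Icc 1 N) ×ˢ (Finset.Icc 1 N)).image
    (fun p : ℕ × ℕ => (a p.1 : ℤ) - (a p.2 : ℤ))).card

/-- `log x`, read as `max {1, log x}`. -/
noncomputable def L (x : ℝ) : ℝ := max 1 (Real.log x)

/-- `log₂ x = log log x`, with the `max {1, ·}` convention. -/
noncomputable def LL (x : ℝ) : ℝ := L (L x)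

/-- `log₃ x = log log log x`, with the `max {1, ·}` convention. -/
noncomputable def LLL (x : ℝ) : ℝ := L (LL x)

/-- The `n`-th prime number (`nthPrime 1 = 2`). -/
noncomputable def nthPrime (n : ℕ) : ℕ := Nat.nth Nat.Prime (n - 1)

theorem nint_neg (x : ℝ) : nint (-x) = nint x := by
  have key (y : ℝ) : nint (-y) ≤ nint y := by
    refine (round_le (-y) (-round y)).trans_eq ?_
    rw [nint, ← abs_neg]
    push_cast
    ring_nf
  exact le_antisymm (key x) (by simpa using key (-x))

theorem nint_natCast_mul_pos {α : ℝ} (hα : Irrational α) {d : ℕ} (hd : d ≠ 0) :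
    0 < nint (d * α) :=
  abs_pos.2 <| sub_ne_zero.2 <| (hα.natCast_mul hd).ne_int _

theorem one_le_L (x : ℝ) : 1 ≤ L x := le_max_left _ _

theorem L_pos (x : ℝ) : 0 < L x := one_pos.trans_le (one_le_L x)

theorem log_le_L (x : ℝ) : Real.log x ≤ L x := le_max_right _ _

theorem L_mono {x y : ℝ} (hx : 0 < x) (hxy : x ≤ y) : L x ≤ L y :=
  max_le_max le_rfl (Real.log_le_log hx hxy)

theorem tendsto_L : Tendsto L atTop atTop :=
  tendsto_atTop_mono log_le_L Real.tendsto_log_atTop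

theorem L_mul_le {c x : ℝ} (hc : 1 ≤ c) (hx : 0 < x) : L (c * x) ≤ c * L x := by
  have h1 := one_le_L x
  refine max_le (by nlinarith) ?_
  rw [Real.log_mul (by positivity) hx.ne']
  have h2 := Real.log_le_sub_one_of_pos (one_pos.trans_le hc)
  have h3 := log_le_L x
  nlinarith

theorem half_L_le {x : ℝ} (hx : 0 < x) : L x / 2 ≤ L (x / 2) := by
  have h := L_mul_le one_le_two (half_pos hx)
  rw [mul_div_cancel₀ x two_ne_zero] at h
  linarith

/-- Positive increasing functions of at most polynomial growth whose reciprocals are summable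
over the natural numbers. -/
structure ConvergentGauge (h : ℝ → ℝ) : Prop where
  pos : ∀ x, 0 < x → 0 < h x
  mono : ∀ x y, 0 < x → x ≤ y → h x ≤ h y
  halving : ∃ κ > 0, ∀ x, 0 < x → κ * h x ≤ h (x / 2)
  summable : Summable fun n : ℕ => (h n)⁻¹

theorem convergentGauge_rpow {p : ℝ} (hp : 1 < p) : ConvergentGauge fun x => x ^ p where
  pos x hx := Real.rpow_pos_of_pos hx p
  mono x y hx hxy := Real.rpow_le_rpow hx.le hxy (by linarith)
  halving := ⟨(2⁻¹ : ℝ) ^ p, by positivity, fun x hx => by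
    rw [← Real.mul_rpow (by norm_num) hx.le, inv_mul_eq_div]⟩
  summable := Real.summable_nat_rpow_inv.2 hp

/-- Cauchy condensation turns a convergent gauge `h` into the convergent gauge `x * h (log x)`. -/
theorem ConvergentGauge.mul_comp_L {h : ℝ → ℝ} (hh : ConvergentGauge h) :
    ConvergentGauge fun x => x * h (L x) := by
  have mono (x y : ℝ) (hx : 0 < x) (hxy : x ≤ y) : x * h (L x) ≤ y * h (L y) :=
    mul_le_mul hxy (hh.mono _ _ (L_pos x) (L_mono hx hxy)) (hh.pos _ (L_pos x)).le
      (hx.le.trans hxy)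
  obtain ⟨κ, hκ, hhalf⟩ := hh.halving
  refine ⟨fun x hx => mul_pos hx (hh.pos _ (L_pos x)), mono,
    ⟨κ / 2, by positivity, fun x hx => ?_⟩, ?_⟩
  · have h1 : κ * h (L x) ≤ h (L (x / 2)) :=
      (hhalf _ (L_pos x)).trans (hh.mono _ _ (half_pos (L_pos x)) (half_L_le hx))
    nlinarith
  · refine (summable_condensed_iff_of_nonneg (fun n => ?_) fun m n hm hmn => ?_).1 ?_
    · exact inv_nonneg.2 (mul_nonneg n.cast_nonneg (hh.pos _ (L_pos _)).le)
    · have hm' : (0 : ℝ) < m := Nat.cast_pos.2 hm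
      exact inv_anti₀ (mul_pos hm' (hh.pos _ (L_pos _))) (mono _ _ hm' (Nat.cast_le.2 hmn))
    · refine Summable.of_norm_bounded_eventually_nat (hh.summable.mul_left κ⁻¹) ?_
      filter_upwards [eventually_gt_atTop 0] with k hk
      have hk' : (0 : ℝ) < k := Nat.cast_pos.2 hk
      have hL : (k : ℝ) / 2 ≤ L (2 ^ k) := by
        refine le_trans ?_ (log_le_L _)
        rw [Real.log_pow]
        nlinarith [Real.log_two_gt_d9]
      have h1 : κ * h k ≤ h (L (2 ^ k)) :=
        (hhalf _ hk').trans (hh.mono _ _ (half_pos hk') hL)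
      have h2 : (0 : ℝ) < 2 ^ k := by positivity
      have h3 := hh.pos _ (L_pos (2 ^ k))
      have h4 := hh.pos _ hk'
      rw [← mul_inv]
      push_cast
      rw [mul_inv, mul_inv_cancel_left₀ h2.ne', Real.norm_of_nonneg (inv_nonneg.2 h3.le)]
      exact inv_anti₀ (by positivity) h1

/-- The volume bound behind the convergence half of Khinchin's theorem. -/
theorem volume_nint_lt_le (d : ℕ) {r : ℝ} (hr : 0 ≤ r) :
    volume (Set.Icc (0 : ℝ) 1 ∩ {α | nint (((d + 1 : ℕ) : ℝ) * α) < r}) ≤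
      ENNReal.ofReal (4 * r) := by
  have hd : (0 : ℝ) < d + 1 := by positivity
  have hsub : Set.Icc (0 : ℝ) 1 ∩ {α | nint (((d + 1 : ℕ) : ℝ) * α) < r} ⊆
      ⋃ k ∈ Finset.range (d + 2), Metric.ball ((k : ℝ) / (d + 1)) (r / (d + 1)) := by
    rintro α ⟨⟨h0, h1⟩, hα⟩
    simp only [Set.mem_ofPred_eq, nint] at hα
    push_cast at hα
    have hround0 : 0 ≤ round (((d : ℝ) + 1) * α) := by
      rw [round_eq]
      exact Int.floor_nonneg.2 (by positivity)
    have hround1 : round (((d : ℝ) + 1) * α) < d + 2 := by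
      rw [round_eq, Int.floor_lt]
      push_cast
      nlinarith
    obtain ⟨k, hk⟩ := Int.eq_ofNat_of_zero_le hround0
    rw [hk] at hα hround1
    simp only [Set.mem_iUnion, Finset.mem_range, Metric.mem_ball, Real.dist_eq]
    refine ⟨k, by omega, ?_⟩
    rw [lt_div_iff₀ hd, ← abs_of_pos hd, ← abs_mul, abs_of_pos hd, sub_mul,
      div_mul_cancel₀ _ hd.ne', mul_comm]
    exact_mod_cast hα
  calc _ ≤ _ := measure_mono hsub
    _ ≤ _ := measure_biUnion_finset_le _ _
    _ = ENNReal.ofReal ((d + 2 : ℕ) * (2 * (r / (d + 1)))) := by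
      simp only [Real.volume_ball, Finset.sum_const, Finset.card_range, nsmul_eq_mul]
      rw [ENNReal.ofReal_mul (Nat.cast_nonneg _), ENNReal.ofReal_natCast]
    _ ≤ _ := by
      refine ENNReal.ofReal_le_ofReal ?_
      push_cast
      rw [← mul_div_assoc, ← mul_div_assoc, div_le_iff₀ hd]
      nlinarith [mul_nonneg hr d.cast_nonneg]

/-- The convergence half of Khinchin's theorem. -/
theorem ae_eventually_le_nint {ψ : ℕ → ℝ} (hψ : ∀ n, 0 ≤ ψ n) (hsum : Summable ψ) :
    ∀ᵐ α ∂(volume : Measure ℝ), α ∈ Set.Icc (0 : ℝ) 1 →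
      ∃ D : ℕ, ∀ d ≥ D, ψ d ≤ nint (d * α) := by
  have hfin : ∑' d : ℕ, volume (Set.Icc (0 : ℝ) 1 ∩
      {α | nint (((d + 1 : ℕ) : ℝ) * α) < ψ (d + 1)}) ≠ ⊤ := by
    refine ne_top_of_le_ne_top ?_ (ENNReal.tsum_le_tsum fun d => volume_nint_lt_le d (hψ (d + 1)))
    exact (((summable_nat_add_iff 1).2 hsum).mul_left 4).tsum_ofReal_ne_top
  filter_upwards [ae_eventually_notMem hfin] with α hα hα01
  obtain ⟨D, hD⟩ := eventually_atTop.1 hα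
  refine ⟨D + 1, fun d hd => ?_⟩
  obtain ⟨e, rfl⟩ := Nat.exists_eq_add_of_le' (Nat.one_le_of_lt hd)
  by_contra hlt
  exact hD e (by omega) ⟨hα01, not_le.1 hlt⟩

theorem nthPrime_prime (n : ℕ) : (nthPrime n).Prime := Nat.prime_nth_prime _

theorem nthPrime_lt {m n : ℕ} (hm : 1 ≤ m) (hmn : m < n) : nthPrime m < nthPrime n :=
  Nat.nth_strictMono Nat.infinite_setOfPred_prime (by omega)

theorem nthPrime_mono {m n : ℕ} (hmn : m ≤ n) : nthPrime m ≤ nthPrime n :=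
  Nat.nth_monotone Nat.infinite_setOfPred_prime (by omega)

theorem primeCounting_nthPrime {n : ℕ} (hn : 1 ≤ n) : (nthPrime n).primeCounting = n := by
  rw [nthPrime, Nat.primeCounting, Nat.primeCounting',
    Nat.count_nth_succ fun hf => absurd hf Nat.infinite_setOfPred_prime]
  omega

/-- An explicit Chebyshev upper bound for the `n`-th prime. -/
theorem nthPrime_le {n : ℕ} (hn : 1 ≤ n) : (nthPrime n : ℝ) ≤ 42 * (n * L n) := by
  have hp2 : (2 : ℝ) ≤ nthPrime n := by exact_mod_cast (nthPrime_prime n).two_le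
  have hn' : (1 : ℝ) ≤ n := by exact_mod_cast hn
  have hpi := Chebyshev.pi_ge (nthPrime n)
  rw [primeCounting_nthPrime hn] at hpi
  generalize (nthPrime n : ℝ) = p at *
  have hp0 : 0 < p := by linarith
  have hlog : 0 < Real.log p := Real.log_pos (by linarith)
  rw [div_le_iff₀ hlog] at hpi
  have h1 : Real.log (p + 1) ≤ 2 * Real.log p := by
    have := Real.log_le_log (by positivity) (show p + 1 ≤ p ^ 2 by nlinarith)
    simpa [Real.log_pow] using this
  have h2 : p ≤ 6 * n * Real.log p := by
    nlinarith [Real.log_two_gt_d9]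
  have hs : 0 < √p := Real.sqrt_pos.2 hp0
  have hsq : √p ^ 2 = p := Real.sq_sqrt hp0.le
  have h3 : Real.log p ≤ 2 * √p := by
    have h5 := Real.log_le_sub_one_of_pos hs
    rw [Real.log_sqrt hp0.le] at h5
    linarith
  have h4 : √p ≤ 12 * n := by
    have : √p * √p ≤ √p * (12 * n) := by nlinarith
    exact le_of_mul_le_mul_left this hs
  have h6 : Real.log p ≤ 7 * L n := by
    have h7 := Real.log_le_log hs h4
    rw [Real.log_sqrt hp0.le, Real.log_mul (by norm_num) (by positivity)] at h7
    have h8 : Real.log 12 ≤ 5 / 2 := by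
      have h9 : Real.log (12 ^ 2) ≤ 5 := by
        rw [Real.log_le_iff_le_exp (by norm_num), show (5 : ℝ) = 2 + 2 + 1 by norm_num,
          Real.exp_add, Real.exp_add, show (2 : ℝ) = 1 + 1 by norm_num, Real.exp_add]
        have he := Real.exp_one_gt_d9
        have h10 : (7.3 : ℝ) ≤ Real.exp 1 * Real.exp 1 := by nlinarith
        have h11 : (53 : ℝ) ≤ Real.exp 1 * Real.exp 1 * (Real.exp 1 * Real.exp 1) := by nlinarith
        nlinarith
      rw [Real.log_pow] at h9
      push_cast at h9
      linarith
    linarith [log_le_L n, one_le_L n]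
  nlinarith

theorem L_mul_L_le {x : ℝ} (hx : 1 ≤ x) : L (42 * (x * L x)) ≤ 6 * L x := by
  have h1 := one_le_L x
  refine max_le (by linarith) ?_
  rw [Real.log_mul (by norm_num) (by positivity), Real.log_mul (by positivity) (by positivity)]
  have h2 : Real.log 42 ≤ 4 := by
    rw [Real.log_le_iff_le_exp (by norm_num), show (4 : ℝ) = 1 + 1 + 1 + 1 by norm_num]
    simp only [Real.exp_add]
    have h3 : (7 : ℝ) ≤ Real.exp 1 * Real.exp 1 := by nlinarith [Real.exp_one_gt_d9]
    nlinarith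
  linarith [log_le_L x, Real.log_le_sub_one_of_pos (L_pos x)]

theorem iterated_log_growth {p x : ℝ} (hp : 0 ≤ p) (hx : 1 ≤ x) {y : ℝ}
    (hy : y = 42 * (x * L x)) :
    y * (L y * (L (L y) * L (L (L y)) ^ p)) ≤
      42 * 6 ^ 2 * 6 ^ p * (x * L x ^ 2 * LL x * LLL x ^ p) := by
  have h1 : L y ≤ 6 * L x := hy ▸ L_mul_L_le hx
  have h2 : L (L y) ≤ 6 * LL x :=
    (L_mono (L_pos _) h1).trans (L_mul_le (by norm_num) (L_pos _))
  have h3 : L (L (L y)) ≤ 6 * LLL x :=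
    (L_mono (L_pos _) h2).trans (L_mul_le (by norm_num) (L_pos _))
  have p1 := L_pos x
  have p2 : 0 < LL x := L_pos _
  have p3 : 0 < LLL x := L_pos _
  have q1 := L_pos y
  have q2 := L_pos (L y)
  have q3 := L_pos (L (L y))
  calc y * (L y * (L (L y) * L (L (L y)) ^ p))
      ≤ 42 * (x * L x) * (6 * L x * (6 * LL x * (6 * LLL x) ^ p)) := by
        rw [← hy]
        have : 0 ≤ y := by rw [hy]; positivity
        gcongr
    _ = _ := by
        rw [Real.mul_rpow (by norm_num) p3.le]
        ring

theorem stmt9 (ε : ℝ) (hε : 0 < ε) :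
    ∀ᵐ α ∂(volume : Measure ℝ), α ∈ Set.Icc (0 : ℝ) 1 →
      ∃ N₀ : ℕ, ∀ N ≥ N₀,
        deltaMin nthPrime α N ≥
          1 / ((N : ℝ) * (L N) ^ 2 * LL N * (LLL N) ^ (1 + ε)) := by
  have hg : ConvergentGauge fun x => x * (L x * (L (L x) * L (L (L x)) ^ (1 + ε / 2))) :=
    (convergentGauge_rpow (by linarith)).mul_comp_L.mul_comp_L.mul_comp_L
  set g : ℝ → ℝ := fun x => x * (L x * (L (L x) * L (L (L x)) ^ (1 + ε / 2))) with hgdef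
  have hg0 (n : ℕ) : 0 ≤ (g n)⁻¹ := by
    rcases n.eq_zero_or_pos with rfl | hn
    · simp [hgdef]
    · exact (inv_pos.2 (hg.pos _ (Nat.cast_pos.2 hn))).le
  filter_upwards [ae_eventually_le_nint hg0 hg.summable,
    (Set.countable_range ((↑) : ℚ → ℝ)).ae_notMem volume] with α hα hirr h01
  obtain ⟨D, hD⟩ := hα h01
  obtain ⟨c, hc, hsmall⟩ : ∃ c > 0, ∀ d : ℕ, d ≠ 0 → d < D → c ≤ nint (d * α) := by
    have key : ∀ᶠ c : ℝ in nhdsWithin 0 (Set.Ioi 0),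
        ∀ d ∈ Finset.range D, d ≠ 0 → c ≤ nint (d * α) := by
      rw [Finset.eventually_all]
      intro d _
      by_cases hd : d = 0
      · simp [hd]
      · filter_upwards [Ioo_mem_nhdsGT (nint_natCast_mul_pos hirr hd)] with c hc _
        exact hc.2.le
    obtain ⟨c, hc, hc0⟩ := (key.and self_mem_nhdsWithin).exists
    exact ⟨c, hc0, fun d hd hdD => hc d (Finset.mem_range.2 hdD) hd⟩
  have hcast := tendsto_natCast_atTop_atTop (R := ℝ)
  have hlarge : ∀ᶠ N : ℕ in atTop,
      42 * 6 ^ 2 * 6 ^ (1 + ε / 2) ≤ LLL N ^ (ε / 2) :=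
    ((tendsto_rpow_atTop (half_pos hε)).comp
      (tendsto_L.comp (tendsto_L.comp (tendsto_L.comp hcast)))).eventually_ge_atTop _
  obtain ⟨N₀, hN₀⟩ := eventually_atTop.1
    (hlarge.and ((hcast.eventually_ge_atTop c⁻¹).and (eventually_ge_atTop 2)))
  refine ⟨N₀, fun N hN => ?_⟩
  obtain ⟨hLLL, hNc, hN2⟩ := hN₀ N hN
  have hN1 : (1 : ℝ) ≤ N := by exact_mod_cast (one_le_two.trans hN2)
  have l1 := one_le_L N
  have l2 : 1 ≤ LL N := one_le_L _
  have l3 : 1 ≤ LLL N := one_le_L _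
  have hNle : (N : ℝ) ≤ N * L N ^ 2 * LL N * LLL N ^ (1 + ε) := by
    have h3 : 1 ≤ LLL N ^ (1 + ε) := Real.one_le_rpow l3 (by linarith)
    rw [mul_assoc, mul_assoc]
    refine le_mul_of_one_le_right (by positivity) ?_
    exact one_le_mul_of_one_le_of_one_le (one_le_pow₀ l1) (one_le_mul_of_one_le_of_one_le l2 h3)
  have hgle : g (42 * (N * L N)) ≤ N * L N ^ 2 * LL N * LLL N ^ (1 + ε) := by
    refine (iterated_log_growth (by linarith) hN1 rfl).trans ?_
    rw [show 1 + ε = ε / 2 + (1 + ε / 2) by ring, Real.rpow_add (by linarith) (ε / 2),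
      show N * L N ^ 2 * LL N * (LLL N ^ (ε / 2) * LLL N ^ (1 + ε / 2)) =
        LLL N ^ (ε / 2) * (N * L N ^ 2 * LL N * LLL N ^ (1 + ε / 2)) by ring]
    gcongr
  have hdiff (d : ℕ) (hd : d ≠ 0) (hdN : d ≤ nthPrime N) :
      1 / (N * L N ^ 2 * LL N * LLL N ^ (1 + ε)) ≤ nint (d * α) := by
    rw [one_div]
    rcases lt_or_ge d D with hlt | hge
    · exact (inv_le_of_inv_le₀ hc (hNc.trans hNle)).trans (hsmall d hd hlt)
    · have hd0 : (0 : ℝ) < d := Nat.cast_pos.2 (Nat.pos_of_ne_zero hd)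
      refine (inv_anti₀ (hg.pos _ hd0) (le_trans ?_ hgle)).trans (hD d hge)
      exact hg.mono _ _ hd0 ((Nat.cast_le.2 hdN).trans (nthPrime_le (one_le_two.trans hN2)))
  have hlt (m n : ℕ) (hm : 1 ≤ m) (hn : n ≤ N) (hmn : m < n) :
      1 / (N * L N ^ 2 * LL N * LLL N ^ (1 + ε)) ≤
        nint (((nthPrime n : ℝ) - nthPrime m) * α) := by
    have h1 := nthPrime_lt hm hmn
    have h2 := nthPrime_mono hn
    rw [← Nat.cast_sub h1.le]
    exact hdiff _ (by omega) (by omega)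
  refine le_csInf ⟨_, 1, 2, le_rfl, by omega, by omega, hN2, by omega, rfl⟩ ?_
  rintro x ⟨m, n, hm1, hmN, hn1, hnN, hne, rfl⟩
  rcases hne.lt_or_gt with h | h
  · rw [← nint_neg, ← neg_mul, neg_sub]
    exact hlt m n hm1 hnN h
  · exact hlt n m hn1 hmN h
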